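/- Let n be an even positive integer and let s be a complex number with Re s > 1. Then Σ_{q=1}^∞ K(n,0;q)/q^{2+s} = (n^{−2s}·σ_s(χ₄;n²) + σ_{−s}(χ₄;n²)) / L(χ₄, 1+s). -/

import Mathlib

open Complex Real MeasureTheory Filter Finset

noncomputable section

/-- The nontrivial Dirichlet character mod 4, extended to `ℤ`, valued in `ℂ`. -/
def chi4 (m : ℤ) : ℂ := if m % 4 = 1 then 1 else if m % 4 = 3 then -1 else 0

/-- `σ_s(χ₄; n) = ∑_{d ∣ n} χ₄(d) d^s`. -/
def sigmaChi4 (s : ℂ) (n : ℕ) : ℂ := ∑ d ∈ n.divisors, chi4 d * (d : ℂ) ^ s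

/-- `σ'_s(χ₄; n) = ∑_{d ∣ n} χ₄(d) d^s log d`. -/
def sigmaChi4' (s : ℂ) (n : ℕ) : ℂ := ∑ d ∈ n.divisors, chi4 d * (d : ℂ) ^ s * (Real.log d : ℂ)

/-- `e(x) = exp(2πix)`. -/
def e2pi (x : ℂ) : ℂ := Complex.exp (2 * (Real.pi : ℂ) * Complex.I * x)

/-- The Dirichlet L-function of the nontrivial character mod 4. -/
def Lchi4 (s : ℂ) : ℂ :=
  DirichletCharacter.LFunction (ZMod.χ₄.ringHomComp (Int.castRingHom ℂ)) s

/-- Generalized quadratic Gauss sum `G(a, n; q)`. -/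
def Gsum (a n : ℤ) (q : ℕ) : ℂ :=
  ∑ x ∈ Finset.range q, e2pi (((a * (x : ℤ) ^ 2 + n * (x : ℤ) : ℤ) : ℂ) / (q : ℂ))

/-- `K(n, l; q) = ∑_{a b ≡ 1 (mod q)} G(a,n;q) G(b,l;q)`. -/
def Ksum (n l : ℤ) (q : ℕ) : ℂ :=
  ∑ a ∈ Finset.range q, ∑ b ∈ Finset.range q,
    if (a * b) % q = 1 % q then Gsum a n q * Gsum b l q else 0

/-- Kloosterman sum `S(m, n; c)`. -/
def kloosterman (m n : ℤ) (c : ℕ) : ℂ :=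
  ∑ x ∈ Finset.range c,
    if Nat.gcd x c = 1 then
      e2pi (((m * (x : ℤ) + n * ((((x : ZMod c)⁻¹).val : ℕ) : ℤ) : ℤ) : ℂ) / (c : ℂ))
    else 0

/-- Ramanujan sum `c_C(m)`. -/
def ramanujanSum (C : ℕ) (m : ℤ) : ℂ :=
  ∑ D ∈ Finset.range C,
    if Nat.gcd D C = 1 then e2pi (((m * (D : ℤ) : ℤ) : ℂ) / (C : ℂ)) else 0

/-- Gauss sum `g(χ₄; q; m)`. -/
def gaussChi4 (q : ℕ) (m : ℤ) : ℂ :=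
  ∑ u ∈ Finset.range q,
    if Nat.gcd u q = 1 then chi4 u * e2pi (((m * (u : ℤ) : ℤ) : ℂ) / (q : ℂ)) else 0

end

/-- `e(j/q)`. -/
noncomputable def EE (q : ℕ) (j : ℤ) : ℂ := e2pi ((j : ℂ) / (q : ℂ))

lemma EE_add (q : ℕ) (i j : ℤ) : EE q (i + j) = EE q i * EE q j := by
  unfold EE e2pi
  rw [← Complex.exp_add]; congr 1; push_cast; ring

lemma EE_zero (q : ℕ) : EE q 0 = 1 := by simp [EE, e2pi]

lemma EE_mul_self (q : ℕ) (hq : 0 < q) (j : ℤ) : EE q (q * j) = 1 := by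
  unfold EE e2pi
  rw [Complex.exp_eq_one_iff]
  refine ⟨j, ?_⟩
  have : (q : ℂ) ≠ 0 := by exact_mod_cast hq.ne'
  push_cast; field_simp

lemma EE_congr (q : ℕ) (hq : 0 < q) {i j : ℤ} (h : (q : ℤ) ∣ i - j) : EE q i = EE q j := by
  obtain ⟨k, hk⟩ := h
  have : i = j + q * k := by linarith
  rw [this, EE_add, EE_mul_self q hq, mul_one]

lemma EE_eq_one_iff (q : ℕ) (hq : 0 < q) (j : ℤ) : EE q j = 1 ↔ (q : ℤ) ∣ j := by
  constructor
  · unfold EE e2pi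
    rw [Complex.exp_eq_one_iff]
    rintro ⟨k, hk⟩
    have : (q : ℂ) ≠ 0 := by exact_mod_cast hq.ne'
    have h2 : (j : ℂ) / q = k := by
      have h3 : (2 * (Real.pi : ℂ) * Complex.I) ≠ 0 := Complex.two_pi_I_ne_zero
      apply mul_left_cancel₀ h3
      rw [hk]; ring
    rw [div_eq_iff this] at h2
    exact ⟨k, by rw [mul_comm]; exact_mod_cast h2⟩
  · rintro ⟨k, rfl⟩; exact EE_mul_self q hq k

lemma EE_mul_nat (q : ℕ) (j : ℤ) (x : ℕ) : EE q (j * x) = EE q j ^ x := by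
  induction x with
  | zero => simp [EE_zero]
  | succ k ih => rw [pow_succ, ← ih, ← EE_add]; congr 1; push_cast; ring

lemma EE_cancel (k q : ℕ) (hk : 0 < k) (j : ℤ) : EE (k * q) (k * j) = EE q j := by
  unfold EE
  have : (k : ℂ) ≠ 0 := by exact_mod_cast hk.ne'
  congr 1; push_cast
  rw [mul_div_mul_left _ _ this]

lemma EE_orth (q : ℕ) (hq : 0 < q) (j : ℤ) :
    ∑ x ∈ Finset.range q, EE q (j * x) = if (q : ℤ) ∣ j then (q : ℂ) else 0 := by
  simp_rw [EE_mul_nat]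
  split_ifs with h
  · rw [(EE_eq_one_iff q hq j).2 h]; simp
  · have h1 : EE q j ≠ 1 := fun h' => h ((EE_eq_one_iff q hq j).1 h')
    rw [geom_sum_eq h1, ← EE_mul_nat, mul_comm, EE_mul_self q hq]; simp

lemma sum_reindex {ι : Type*} (q : ℕ) (hq : 0 < q) (S : Finset ι) (g : ι → ℤ) (f : ℤ → ℂ)
    (hcard : S.card = q) (inj : ∀ x ∈ S, ∀ y ∈ S, (q : ℤ) ∣ g x - g y → x = y)
    (hf : ∀ x y : ℤ, (q : ℤ) ∣ x - y → f x = f y) :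
    ∑ x ∈ S, f (g x) = ∑ x ∈ Finset.range q, f x := by
  have hq' : (q : ℤ) ≠ 0 := by exact_mod_cast hq.ne'
  have hmaps : ∀ x ∈ S, (g x % q).toNat ∈ Finset.range q := by
    intro x _
    have h1 := Int.emod_nonneg (g x) hq'
    have h2 := Int.emod_lt_of_pos (g x) (by exact_mod_cast hq : (0 : ℤ) < q)
    rw [Finset.mem_range]; omega
  have hcast : ∀ x, (((g x % q).toNat : ℕ) : ℤ) = g x % q := fun x =>
    Int.toNat_of_nonneg (Int.emod_nonneg (g x) hq')
  have hinj : Set.InjOn (fun x => (g x % q).toNat) S := by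
    intro x hx y hy hxy
    apply inj x hx y hy
    have : g x % q = g y % q := by
      have hxy' : (g x % q).toNat = (g y % q).toNat := hxy
      rw [← hcast x, ← hcast y, hxy']
    exact Int.ModEq.dvd this.symm
  refine Finset.sum_nbij (fun x => (g x % q).toNat) hmaps hinj ?_ ?_
  · exact Finset.surjOn_of_injOn_of_card_le _ hmaps hinj (by simp [hcard])
  · intro x _
    apply hf
    rw [hcast]
    exact Int.dvd_self_sub_emod

lemma sum_range_dvd (p m : ℕ) (hp : 0 < p) (f : ℤ → ℂ) :
    ∑ x ∈ Finset.range (p * m), (if p ∣ x then f x else 0) =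
      ∑ w ∈ Finset.range m, f (p * w) := by
  rw [← Finset.sum_filter]
  symm
  refine Finset.sum_nbij (fun w => p * w) ?_ ?_ ?_ ?_
  · intro w hw
    simp only [Finset.mem_range, Finset.mem_filter] at *
    exact ⟨Nat.mul_lt_mul_of_pos_left hw hp, dvd_mul_right _ _⟩
  · intro x _ y _ h; exact Nat.eq_of_mul_eq_mul_left hp h
  · intro x hx
    simp only [Finset.coe_filter, Finset.mem_range, Set.mem_ofPred_eq] at hx
    obtain ⟨h, w, rfl⟩ := hx
    exact ⟨w, by simpa using Nat.lt_of_mul_lt_mul_left h, rfl⟩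
  · intro w _; push_cast; rfl

lemma sum_range_periodic (p r : ℕ) (f : ℤ → ℂ)
    (hf : ∀ x y : ℤ, (r : ℤ) ∣ x - y → f x = f y) :
    ∑ x ∈ Finset.range (p * r), f x = p * ∑ x ∈ Finset.range r, f x := by
  induction p with
  | zero => simp
  | succ k ih =>
    rw [add_mul, one_mul, Finset.sum_range_add, ih]
    have : ∀ x ∈ Finset.range r, f ((k * r + x : ℕ) : ℤ) = f x := by
      intro x _; apply hf; push_cast; exact ⟨k, by ring⟩
    rw [Finset.sum_congr rfl this]; push_cast; ring

lemma Gsum_eq (a n : ℤ) (q : ℕ) :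
    Gsum a n q = ∑ x ∈ Finset.range q, EE q (a * (x : ℤ) ^ 2 + n * x) := rfl

lemma Gsum_zero_eq (a : ℤ) (q : ℕ) :
    Gsum a 0 q = ∑ x ∈ Finset.range q, EE q (a * (x : ℤ) ^ 2) := by
  rw [Gsum_eq]; simp

lemma EE_quad_periodic (q : ℕ) (hq : 0 < q) (a n : ℤ) (x y : ℤ) (h : (q : ℤ) ∣ x - y) :
    EE q (a * x ^ 2 + n * x) = EE q (a * y ^ 2 + n * y) := by
  apply EE_congr q hq
  obtain ⟨k, hk⟩ := h
  exact ⟨k * (a * (x + y) + n), by linear_combination (a * (x + y) + n) * hk⟩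

lemma EE_sq_periodic (q : ℕ) (hq : 0 < q) (a : ℤ) (x y : ℤ) (h : (q : ℤ) ∣ x - y) :
    EE q (a * x ^ 2) = EE q (a * y ^ 2) := by
  simpa using EE_quad_periodic q hq a 0 x y h

/-- shift -/
lemma sum_shift (q : ℕ) (hq : 0 < q) (f : ℤ → ℂ) (c : ℤ)
    (hf : ∀ x y : ℤ, (q : ℤ) ∣ x - y → f x = f y) :
    ∑ x ∈ Finset.range q, f (x + c) = ∑ x ∈ Finset.range q, f x := by
  refine sum_reindex q hq (Finset.range q) (fun x => (x : ℤ) + c) f (by simp) ?_ hf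
  intro x hx y hy h
  simp only [Finset.mem_range] at hx hy
  have h' : (q : ℤ) ∣ (x : ℤ) - y := by simpa using h
  have := Int.eq_zero_of_abs_lt_dvd h' (by rw [abs_lt]; constructor <;> omega)
  omega

lemma sum_unit (q : ℕ) (hq : 0 < q) (f : ℤ → ℂ) (a b : ℤ) (hab : (q : ℤ) ∣ a * b - 1)
    (hf : ∀ x y : ℤ, (q : ℤ) ∣ x - y → f x = f y) :
    ∑ x ∈ Finset.range q, f (a * x) = ∑ x ∈ Finset.range q, f x := by
  refine sum_reindex q hq (Finset.range q) (fun x => a * (x : ℤ)) f (by simp) ?_ hf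
  intro x hx y hy h
  simp only [Finset.mem_range] at hx hy
  have h' : (q : ℤ) ∣ (x : ℤ) - y := by
    have h2 : (q : ℤ) ∣ b * (a * x - a * y) := Dvd.dvd.mul_left h _
    have h3 : (q : ℤ) ∣ (a * b - 1) * (x - y) := Dvd.dvd.mul_right hab _
    have := dvd_sub h2 h3
    ring_nf at this ⊢
    exact this
  have := Int.eq_zero_of_abs_lt_dvd h' (by rw [abs_lt]; constructor <;> omega)
  omega

lemma Gsum_complete (q : ℕ) (hq : 0 < q) (a b m : ℤ) (hab : (q : ℤ) ∣ a * b - 1) :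
    Gsum a (2 * m) q = EE q (-(b * m ^ 2)) * Gsum a 0 q := by
  rw [Gsum_eq, Gsum_zero_eq, ← sum_shift q hq (fun x => EE q (a * x ^ 2)) (b * m)
    (EE_sq_periodic q hq a), Finset.mul_sum]
  refine Finset.sum_congr rfl fun x _ => ?_
  rw [← EE_add]
  apply EE_congr q hq
  obtain ⟨k, hk⟩ := hab
  exact ⟨-k * (2 * m * x + b * m ^ 2), by
    linear_combination (-(2 * m * x + b * m ^ 2)) * hk⟩

lemma Gsum_inv (q : ℕ) (hq : 0 < q) (a b : ℤ) (hab : (q : ℤ) ∣ a * b - 1) :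
    Gsum a 0 q = Gsum b 0 q := by
  rw [Gsum_zero_eq, Gsum_zero_eq, ← sum_unit q hq (fun x => EE q (b * x ^ 2)) a b hab
    (EE_sq_periodic q hq b)]
  refine Finset.sum_congr rfl fun x _ => ?_
  apply EE_congr q hq
  obtain ⟨k, hk⟩ := hab
  exact ⟨-k * a * x ^ 2, by linear_combination (-a * x ^ 2) * hk⟩

/-- multiplicativity -/
lemma Gsum_mul (q r : ℕ) (hq : 0 < q) (hr : 0 < r) (h : Nat.Coprime q r) (a : ℤ) :
    Gsum a 0 (q * r) = Gsum (a * q) 0 r * Gsum (a * r) 0 q := by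
  have hqr : 0 < q * r := Nat.mul_pos hq hr
  rw [Gsum_zero_eq, Gsum_zero_eq, Gsum_zero_eq, Finset.sum_mul_sum, ← Finset.sum_product',
    ← sum_reindex (q * r) hqr (Finset.range r ×ˢ Finset.range q)
      (fun x => (x.1 : ℤ) * q + x.2 * r) (fun x => EE (q * r) (a * x ^ 2)) (by simp [mul_comm]) ?_
      (EE_sq_periodic _ hqr a)]
  · refine Finset.sum_congr rfl fun x _ => ?_
    rw [← EE_cancel q r hq, ← EE_cancel r q hr, mul_comm r q, ← EE_add]
    apply EE_congr _ hqr
    push_cast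
    exact ⟨2 * a * x.1 * x.2, by ring⟩
  · rintro ⟨x, y⟩ hx ⟨x', y'⟩ hy hd
    simp only [Finset.mem_product, Finset.mem_range] at hx hy
    have hc : IsCoprime (q : ℤ) (r : ℤ) := Nat.isCoprime_iff_coprime.2 h
    push_cast at hd
    have e1 : (r : ℤ) ∣ (x : ℤ) - x' := by
      have h1 : (r : ℤ) ∣ (q : ℤ) * ((x : ℤ) - x') := by
        have h2 := (dvd_mul_left (r : ℤ) q).trans hd
        have h3 : (r : ℤ) ∣ (r : ℤ) * ((y : ℤ) - y') := dvd_mul_right _ _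
        have := dvd_sub h2 h3
        ring_nf at this ⊢
        exact this
      exact hc.symm.dvd_of_dvd_mul_left h1
    have e2 : (q : ℤ) ∣ (y : ℤ) - y' := by
      have h1 : (q : ℤ) ∣ (r : ℤ) * ((y : ℤ) - y') := by
        have h2 := (dvd_mul_right (q : ℤ) r).trans hd
        have h3 : (q : ℤ) ∣ (q : ℤ) * ((x : ℤ) - x') := dvd_mul_right _ _
        have := dvd_sub h2 h3
        ring_nf at this ⊢
        exact this
      exact hc.dvd_of_dvd_mul_left h1
    have := Int.eq_zero_of_abs_lt_dvd e1 (by rw [abs_lt]; constructor <;> omega)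
    have := Int.eq_zero_of_abs_lt_dvd e2 (by rw [abs_lt]; constructor <;> omega)
    ext <;> simp <;> omega

/-- descent: `t` the shift, `2 t a = c (q/p)`. -/
lemma Gsum_descent (p r : ℕ) (hp : 0 < p) (hr : 0 < r) (a t c : ℤ)
    (h1 : 2 * t * a = c * (p * r)) (h2 : (p ^ 2 * r : ℤ) ∣ t ^ 2) (hc : IsCoprime c (p : ℤ)) :
    Gsum a 0 (p ^ 2 * r) = p * Gsum a 0 r := by
  have hq : 0 < p ^ 2 * r := by positivity
  have hp0 : (p : ℂ) ≠ 0 := by exact_mod_cast hp.ne'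
  have key : (p : ℂ) * Gsum a 0 (p ^ 2 * r) =
      p * ∑ x ∈ Finset.range (p ^ 2 * r),
        (if p ∣ x then EE (p ^ 2 * r) (a * (x : ℤ) ^ 2) else 0) := by
    have e1 : (p : ℂ) * Gsum a 0 (p ^ 2 * r) = ∑ j ∈ Finset.range p,
        ∑ x ∈ Finset.range (p ^ 2 * r), EE (p ^ 2 * r) (a * ((x : ℤ) + j * t) ^ 2) := by
      have : ∀ j ∈ Finset.range p, ∑ x ∈ Finset.range (p ^ 2 * r),
          EE (p ^ 2 * r) (a * ((x : ℤ) + j * t) ^ 2) = Gsum a 0 (p ^ 2 * r) := by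
        intro j _
        rw [Gsum_zero_eq]
        exact sum_shift _ hq (fun x => EE (p ^ 2 * r) (a * x ^ 2)) _ (EE_sq_periodic _ hq a)
      rw [Finset.sum_congr rfl this]; simp
    rw [e1, Finset.sum_comm, Finset.mul_sum]
    refine Finset.sum_congr rfl fun x _ => ?_
    have e2 : ∀ j ∈ Finset.range p, EE (p ^ 2 * r) (a * ((x : ℤ) + j * t) ^ 2) =
        EE (p ^ 2 * r) (a * (x : ℤ) ^ 2) * EE p ((c * x) * j) := by
      intro j _
      rw [← EE_cancel (p * r) p (by positivity), show p * r * p = p ^ 2 * r by ring, ← EE_add]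
      apply EE_congr _ hq
      obtain ⟨k, hk⟩ := h2
      push_cast
      exact ⟨a * j ^ 2 * k, by linear_combination (x * j : ℤ) * h1 + (a * j ^ 2) * hk⟩
    rw [Finset.sum_congr rfl e2, ← Finset.mul_sum, EE_orth p hp]
    have : (p : ℤ) ∣ c * x ↔ p ∣ x := by
      rw [← Int.natCast_dvd_natCast]
      exact ⟨fun h => hc.symm.dvd_of_dvd_mul_left h, fun h => Dvd.dvd.mul_left h _⟩
    simp only [this]
    split_ifs <;> ring
  have key2 := mul_left_cancel₀ hp0 key
  rw [key2, show p ^ 2 * r = p * (p * r) by ring,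
    sum_range_dvd p (p * r) hp (fun x => EE (p * (p * r)) (a * x ^ 2)), Gsum_zero_eq,
    ← sum_range_periodic p r (fun x => EE r (a * x ^ 2)) (EE_sq_periodic r hr a)]
  refine Finset.sum_congr rfl fun x _ => ?_
  rw [← EE_cancel (p * p) r (by positivity), mul_assoc]
  congr 1; push_cast; ring

lemma chi4_eq (m : ℤ) : chi4 m = ((ZMod.χ₄ (m : ZMod 4) : ℤ) : ℂ) := by
  rw [ZMod.χ₄_int_eq_if_mod_four, chi4]
  split_ifs <;> simp <;> omega

lemma chi4_mul (a b : ℤ) : chi4 (a * b) = chi4 a * chi4 b := by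
  rw [chi4_eq, chi4_eq, chi4_eq, Int.cast_mul, map_mul, Int.cast_mul]

lemma EE_eq_std (p : ℕ) [NeZero p] (j : ℤ) : EE p j = ZMod.stdAddChar (j : ZMod p) := by
  rw [ZMod.stdAddChar_coe, EE, e2pi]; congr 1; ring

lemma sum_range_zmod (p : ℕ) [NeZero p] (f : ZMod p → ℂ) :
    ∑ x ∈ Finset.range p, f (x : ZMod p) = ∑ x : ZMod p, f x := by
  refine Finset.sum_nbij' (fun x => (x : ZMod p)) (fun x => x.val) ?_ ?_ ?_ ?_ ?_
  · simp
  · intro x _; simpa using ZMod.val_lt x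
  · intro x hx; simp only [Finset.mem_range] at hx; exact ZMod.val_cast_of_lt hx
  · intro x _; simp
  · simp

lemma Gsum_sq_prime (p : ℕ) [Fact p.Prime] (hp2 : p ≠ 2) (a : ℤ) (ha : IsCoprime a (p : ℤ)) :
    Gsum a 0 p ^ 2 = chi4 p * p := by
  have hF : ringChar (ZMod p) ≠ 2 := by rwa [ZMod.ringChar_zmod_n]
  have hpP : p.Prime := Fact.out
  have ha0 : (a : ZMod p) ≠ 0 := by
    intro h
    rw [ZMod.intCast_zmod_eq_zero_iff_dvd] at h
    have := ha.isUnit_of_dvd' h dvd_rfl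
    rw [Int.isUnit_iff] at this
    have := hpP.two_le
    omega
  set ψ : AddChar (ZMod p) ℂ := (ZMod.stdAddChar (N := p)).mulShift (a : ZMod p) with hψ
  have hprim : ψ.IsPrimitive := by
    rw [AddChar.IsPrimitive]
    intro b hb
    rw [hψ, AddChar.mulShift_mulShift]
    exact ZMod.isPrimitive_stdAddChar p (mul_ne_zero ha0 hb)
  have hψ1 : ψ ≠ 1 := by
    have := hprim (one_ne_zero)
    rwa [AddChar.mulShift_one] at this
  set χ : MulChar (ZMod p) ℂ := (quadraticChar (ZMod p)).ringHomComp (Int.castRingHom ℂ) with hχ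
  have hG : Gsum a 0 p = gaussSum χ ψ := by
    rw [Gsum_zero_eq]
    have e1 : ∀ x ∈ Finset.range p, EE p (a * (x : ℤ) ^ 2) = ψ ((x : ZMod p) ^ 2) := by
      intro x _
      rw [EE_eq_std, hψ, AddChar.mulShift_apply]; push_cast; rfl
    rw [Finset.sum_congr rfl e1, sum_range_zmod p (fun x => ψ (x ^ 2))]
    rw [← Finset.sum_fiberwise (s := Finset.univ) (g := fun x : ZMod p => x ^ 2)]
    have e2 : ∀ u ∈ (Finset.univ : Finset (ZMod p)),
        ∑ x ∈ Finset.univ with x ^ 2 = u, ψ (x ^ 2) = χ u * ψ u + ψ u := by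
      intro u _
      have : ∀ x ∈ (Finset.univ.filter fun x : ZMod p => x ^ 2 = u), ψ (x ^ 2) = ψ u := by
        intro x hx; simp only [Finset.mem_filter] at hx; rw [hx.2]
      rw [Finset.sum_congr rfl this, Finset.sum_const, nsmul_eq_mul]
      have hc := quadraticChar_card_sqrts hF u
      have h3 : ({x : ZMod p | x ^ 2 = u}.toFinset) = (Finset.univ.filter fun x : ZMod p => x ^ 2 = u) := by
        ext; simp
      rw [h3] at hc
      have hc' : (((Finset.univ.filter fun x : ZMod p => x ^ 2 = u).card : ℕ) : ℂ) = χ u + 1 := by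
        rw [hχ, MulChar.ringHomComp_apply]
        have := congrArg (fun z : ℤ => (z : ℂ)) hc
        push_cast at this
        simpa using this
      rw [hc']; ring
    rw [Finset.sum_congr rfl e2, Finset.sum_add_distrib, AddChar.sum_eq_zero_of_ne_one hψ1, add_zero]
    rfl
  have hχ1 : χ ≠ 1 := by
    intro h
    apply quadraticChar_ne_one hF
    ext u
    have := congrArg (fun c : MulChar (ZMod p) ℂ => c u) h
    simp only [hχ, MulChar.ringHomComp_apply, MulChar.one_apply_coe] at this
    rw [MulChar.one_apply_coe]
    simpa using this
  have hχ2 : χ.IsQuadratic := (quadraticChar_isQuadratic (ZMod p)).comp _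
  rw [hG, gaussSum_sq hχ1 hχ2 hprim, ZMod.card, chi4_eq, hχ, MulChar.ringHomComp_apply,
    quadraticChar_neg_one hF, ZMod.card]
  simp

/-- the normalized square of the Gauss sum -/
noncomputable def eps (a : ℤ) (q : ℕ) : ℂ :=
  if q % 2 = 1 then chi4 q else if q % 4 = 0 then 2 * Complex.I * chi4 a else 0

lemma chi4_sq_of_odd (m : ℤ) (h : m % 2 = 1) : chi4 m * chi4 m = 1 := by
  unfold chi4; split_ifs <;> simp <;> omega

lemma chi4_even (m : ℤ) (h : m % 2 = 0) : chi4 m = 0 := by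
  unfold chi4; split_ifs <;> simp <;> omega

lemma eps_mul (a : ℤ) (q r : ℕ) (h : Nat.Coprime q r) :
    eps (a * q) r * eps (a * r) q = eps a (q * r) := by
  have hnot : ¬ (q % 2 = 0 ∧ r % 2 = 0) := by
    rintro ⟨h1, h2⟩
    have := Nat.dvd_gcd (Nat.dvd_of_mod_eq_zero h1) (Nat.dvd_of_mod_eq_zero h2)
    rw [Nat.Coprime] at h; rw [h] at this; omega
  rcases Nat.mod_two_eq_zero_or_one q with hq | hq <;>
  rcases Nat.mod_two_eq_zero_or_one r with hr | hr
  · exact absurd ⟨hq, hr⟩ hnot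
  · have h1 : (q * r) % 2 = 0 := by simp [Nat.mul_mod, hq]
    have h2 : (q * r) % 4 = 0 ↔ q % 4 = 0 := by
      rcases (by omega : q % 4 = 0 ∨ q % 4 = 2) with hq4 | hq4 <;>
      rcases (by omega : r % 4 = 1 ∨ r % 4 = 3) with hr4 | hr4 <;> simp [Nat.mul_mod, hq4, hr4]
    unfold eps
    simp only [hr, hq, h1, h2, if_true, zero_ne_one, if_false]
    split_ifs
    · rw [chi4_mul]
      linear_combination (2 * Complex.I * chi4 a) * chi4_sq_of_odd r (by omega)
    · simp
  · have h1 : (q * r) % 2 = 0 := by simp [Nat.mul_mod, hr]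
    have h2 : (q * r) % 4 = 0 ↔ r % 4 = 0 := by
      rcases (by omega : r % 4 = 0 ∨ r % 4 = 2) with hq4 | hq4 <;>
      rcases (by omega : q % 4 = 1 ∨ q % 4 = 3) with hr4 | hr4 <;> simp [Nat.mul_mod, hq4, hr4]
    unfold eps
    simp only [hr, hq, h1, h2, if_true, zero_ne_one, if_false]
    split_ifs
    · rw [chi4_mul]
      linear_combination (2 * Complex.I * chi4 a) * chi4_sq_of_odd q (by omega)
    · simp
  · have h1 : (q * r) % 2 = 1 := by simp [Nat.mul_mod, hq, hr]
    unfold eps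
    simp only [hr, hq, h1, if_true]
    push_cast
    rw [chi4_mul]; ring

lemma EE_two_one : EE 2 1 = -1 := by
  unfold EE e2pi
  rw [← Complex.exp_pi_mul_I]; congr 1; push_cast; ring

lemma EE_four_one : EE 4 1 = Complex.I := by
  unfold EE e2pi
  refine Eq.trans ?_ Complex.exp_pi_div_two_mul_I
  congr 1; push_cast; ring

lemma EE_four_three : EE 4 3 = -Complex.I := by
  rw [show (3 : ℤ) = 1 * ((3 : ℕ) : ℤ) by norm_num, EE_mul_nat, EE_four_one]
  rw [pow_succ, Complex.I_sq]; ring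

lemma EE_four_odd (a : ℤ) (ha : a % 2 = 1) : EE 4 a = Complex.I * chi4 a := by
  rcases (by omega : a % 4 = 1 ∨ a % 4 = 3) with h | h
  · rw [EE_congr 4 (by norm_num) (j := 1) (by push_cast; omega), EE_four_one]
    simp [chi4, h]
  · rw [EE_congr 4 (by norm_num) (j := 3) (by push_cast; omega), EE_four_three]
    simp [chi4, h]

lemma Gsum_two (a : ℤ) (ha : a % 2 = 1) : Gsum a 0 2 = 0 := by
  rw [Gsum_zero_eq]
  simp only [Finset.sum_range_succ, Finset.sum_range_zero]
  rw [EE_congr 2 (by norm_num) (i := a * ((1 : ℕ) : ℤ) ^ 2) (j := 1) (by push_cast; omega),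
    EE_two_one]
  simp [EE_zero]

lemma Gsum_four (a : ℤ) (ha : a % 2 = 1) : Gsum a 0 4 ^ 2 = 2 * Complex.I * chi4 a * 4 := by
  have h1 := EE_four_odd a ha
  have : Gsum a 0 4 = 2 + 2 * EE 4 a := by
    rw [Gsum_zero_eq]
    simp only [Finset.sum_range_succ, Finset.sum_range_zero]
    rw [EE_congr 4 (by norm_num) (i := a * ((3 : ℕ) : ℤ) ^ 2) (j := a) (by push_cast; omega),
      EE_congr 4 (by norm_num) (i := a * ((2 : ℕ) : ℤ) ^ 2) (j := 0) (by push_cast; omega)]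
    simp [EE_zero]; ring
  rw [this, h1]
  linear_combination 4 * chi4 a * chi4 a * Complex.I_sq - 4 * chi4_sq_of_odd a ha

lemma Gsum_eight (a : ℤ) (ha : a % 2 = 1) : Gsum a 0 8 ^ 2 = 2 * Complex.I * chi4 a * 8 := by
  have h1 := EE_four_odd a ha
  have h2 : EE 8 (4 * a) = -1 := by
    have := EE_cancel 4 2 (by norm_num) a
    norm_num at this
    rw [this, EE_congr 2 (by norm_num) (j := 1) (by push_cast; omega), EE_two_one]
  have : Gsum a 0 8 = 4 * EE 8 a := by
    rw [Gsum_zero_eq]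
    simp only [Finset.sum_range_succ, Finset.sum_range_zero]
    rw [EE_congr 8 (by norm_num) (i := a * ((3 : ℕ) : ℤ) ^ 2) (j := a) (by push_cast; omega),
      EE_congr 8 (by norm_num) (i := a * ((5 : ℕ) : ℤ) ^ 2) (j := a) (by push_cast; omega),
      EE_congr 8 (by norm_num) (i := a * ((7 : ℕ) : ℤ) ^ 2) (j := a) (by push_cast; omega),
      EE_congr 8 (by norm_num) (i := a * ((1 : ℕ) : ℤ) ^ 2) (j := a) (by push_cast; omega),
      EE_congr 8 (by norm_num) (i := a * ((2 : ℕ) : ℤ) ^ 2) (j := 4 * a) (by push_cast; omega),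
      EE_congr 8 (by norm_num) (i := a * ((6 : ℕ) : ℤ) ^ 2) (j := 4 * a) (by push_cast; omega),
      EE_congr 8 (by norm_num) (i := a * ((4 : ℕ) : ℤ) ^ 2) (j := 0) (by push_cast; omega),
      EE_congr 8 (by norm_num) (i := a * ((0 : ℕ) : ℤ) ^ 2) (j := 0) (by push_cast; omega), h2]
    simp [EE_zero]; ring
  have h3 : EE 8 a ^ 2 = EE 4 a := by
    rw [sq, ← EE_add]
    have := EE_cancel 2 4 (by norm_num) a
    norm_num at this
    rw [← this]; congr 1; ring
  rw [this, mul_pow, h3, h1]; ring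

lemma Gsum_sq_two_pow (k : ℕ) (hk : 0 < k) (a : ℤ) (ha : a % 2 = 1) :
    Gsum a 0 (2 ^ k) ^ 2 = eps a (2 ^ k) * (2 ^ k : ℕ) := by
  induction k using Nat.strong_induction_on with
  | _ k ih =>
    rcases k with _ | _ | _ | _ | k
    · omega
    · simp [eps, Gsum_two a ha]
    · have := Gsum_four a ha
      norm_num [eps] at this ⊢; exact this
    · have := Gsum_eight a ha
      norm_num [eps] at this ⊢; exact this
    · have h1 := ih (k + 2) (by omega) (by omega)
      have h4 : 2 ^ (k + 4) = 2 ^ 2 * 2 ^ (k + 2) := by ring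
      have hd := Gsum_descent 2 (2 ^ (k + 2)) (by norm_num) (by positivity) a (2 ^ (k + 2)) a
        (by push_cast; ring) (by push_cast; exact ⟨2 ^ k, by ring⟩)
        (by
          have : a.gcd 2 = 1 := by
            rw [← Int.isCoprime_iff_gcd_eq_one]
            exact ⟨1, -(a / 2), by omega⟩
          exact_mod_cast Int.isCoprime_iff_gcd_eq_one.2 this)
      have he : eps a (2 ^ (k + 4)) = eps a (2 ^ (k + 2)) := by
        have e1 : ∀ j, 2 ^ (j + 2) % 4 = 0 ∧ 2 ^ (j + 2) % 2 = 0 := by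
          intro j; rw [pow_add]; omega
        simp [eps, (e1 k).1, (e1 k).2, (e1 (k + 2)).1, (e1 (k + 2)).2]
      change Gsum a 0 (2 ^ (k + 4)) ^ 2 = eps a (2 ^ (k + 4)) * (2 ^ (k + 4) : ℕ)
      rw [he, h4, hd, mul_pow, h1]; push_cast; ring

lemma Gsum_sq_odd_pow (p k : ℕ) (hp : p.Prime) (hp2 : p ≠ 2) (a : ℤ) (ha : IsCoprime a (p : ℤ)) :
    Gsum a 0 (p ^ k) ^ 2 = eps a (p ^ k) * (p ^ k : ℕ) := by
  have hodd : p % 2 = 1 := hp.eq_two_or_odd.resolve_left hp2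
  have ho : ∀ j, p ^ j % 2 = 1 := fun j => by simp [Nat.pow_mod, hodd]
  induction k using Nat.strong_induction_on with
  | _ k ih =>
    rcases k with _ | _ | k
    · simp [Gsum_zero_eq, EE_zero, eps, chi4]
    · haveI : Fact p.Prime := ⟨hp⟩
      simp [eps, hodd, Gsum_sq_prime p hp2 a ha]
    · have h1 := ih k (by omega)
      have h4 : p ^ (k + 2) = p ^ 2 * p ^ k := by ring
      have hd := Gsum_descent p (p ^ k) hp.pos (pow_pos hp.pos _) a (p ^ (k + 1)) (2 * a)
        (by push_cast; ring) (by push_cast; exact ⟨p ^ k, by ring⟩)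
        (by
          apply IsCoprime.mul_left _ ha
          exact ⟨-(p / 2 : ℤ), 1, by omega⟩)
      have he : eps a (p ^ (k + 2)) = eps a (p ^ k) := by
        simp only [eps, ho, if_true]
        rw [h4]; push_cast
        rw [chi4_mul, sq, chi4_mul, chi4_sq_of_odd _ (by omega), one_mul]
      change Gsum a 0 (p ^ (k + 2)) ^ 2 = eps a (p ^ (k + 2)) * (p ^ (k + 2) : ℕ)
      rw [he, h4, hd, mul_pow, h1]; push_cast; ring

lemma Gsum_sq (q : ℕ) (hq : 0 < q) (a : ℤ) (ha : IsCoprime a (q : ℤ)) :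
    Gsum a 0 q ^ 2 = eps a q * q := by
  induction q using Nat.recOnPosPrimePosCoprime generalizing a with
  | zero => omega
  | one => simp [Gsum_zero_eq, EE_zero, eps, chi4]
  | prime_pow p k hp hk =>
    push_cast at ha
    rw [IsCoprime.pow_right_iff hk] at ha
    by_cases h2 : p = 2
    · subst h2
      refine Gsum_sq_two_pow k hk a ?_
      obtain ⟨u, v, huv⟩ := ha
      by_contra h
      have h0 : a % 2 = 0 := by omega
      have : (2 : ℤ) ∣ 1 := by
        rw [← huv]
        exact dvd_add (Dvd.dvd.mul_left (Int.dvd_of_emod_eq_zero h0) _) (by simp)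
      omega
    · exact Gsum_sq_odd_pow p k hp h2 a ha
  | coprime q r hq1 hr1 hqr ihq ihr =>
    have hc : IsCoprime (q : ℤ) (r : ℤ) := Nat.isCoprime_iff_coprime.2 hqr
    push_cast at ha
    have haq := IsCoprime.of_mul_right_left ha
    have har := IsCoprime.of_mul_right_right ha
    rw [Gsum_mul q r (by omega) (by omega) hqr, mul_pow,
      ihr (by omega) _ (har.mul_left hc), ihq (by omega) _ (haq.mul_left hc.symm), ← eps_mul a q r hqr]
    push_cast; ring

lemma sum_inv_mod (q : ℕ) (hq : 0 < q) (b : ℕ) (X : ℂ) :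
    ∑ a ∈ Finset.range q, (if (a * b) % q = 1 % q then X else 0) =
      if Nat.Coprime b q then X else 0 := by
  split_ifs with h
  · have : NeZero q := ⟨hq.ne'⟩
    have key : ∀ a ∈ Finset.range q, ((a * b) % q = 1 % q ↔ a = ((b : ZMod q)⁻¹).val) := by
      intro a ha
      rw [Finset.mem_range] at ha
      have h1 : (a * b) % q = 1 % q ↔ (a : ZMod q) * b = 1 := by
        have := ZMod.natCast_eq_natCast_iff (a * b) 1 q
        push_cast at this
        rw [this]; rfl
      have hb : (b : ZMod q) * (b : ZMod q)⁻¹ = 1 := ZMod.coe_mul_inv_eq_one b h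
      rw [h1]
      constructor
      · intro h2
        have : (a : ZMod q) = (b : ZMod q)⁻¹ := by
          calc (a : ZMod q) = a * (b * (b : ZMod q)⁻¹) := by rw [hb, mul_one]
            _ = (a * b) * (b : ZMod q)⁻¹ := by ring
            _ = _ := by rw [h2, one_mul]
        rw [← this, ZMod.val_cast_of_lt ha]
      · intro h2
        rw [h2, ZMod.natCast_zmod_val, mul_comm, hb]
    rw [Finset.sum_congr rfl (fun a ha => by rw [if_congr (key a ha) rfl rfl]),
      Finset.sum_ite_eq']
    simp [ZMod.val_lt]
  · apply Finset.sum_eq_zero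
    intro a _
    rw [if_neg]
    intro h2
    apply h
    have h3 : Nat.Coprime (a * b) q := by
      have h4 : (a * b) ≡ 1 [MOD q] := h2
      rw [Nat.Coprime, h4.gcd_eq]; simp
    exact Nat.Coprime.coprime_mul_left h3

lemma Ksum_eq (q : ℕ) (hq : 0 < q) (m : ℤ) :
    Ksum (2 * m) 0 q = q * ∑ b ∈ Finset.range q,
      (if Nat.Coprime b q then eps b q * EE q (-(b * m ^ 2)) else 0) := by
  unfold Ksum
  rw [Finset.sum_comm, Finset.mul_sum]
  refine Finset.sum_congr rfl fun b _ => ?_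
  rw [← sum_inv_mod q hq, Finset.mul_sum]
  refine Finset.sum_congr rfl fun a _ => ?_
  rw [mul_ite, mul_zero]
  refine if_ctx_congr Iff.rfl (fun h => ?_) (fun _ => rfl)
  have hd : (q : ℤ) ∣ (a : ℤ) * b - 1 := by
    have h4 : 1 ≡ (a * b) [MOD q] := h.symm
    have := (Nat.modEq_iff_dvd.1 h4)
    push_cast at this; exact this
  have hc : IsCoprime (b : ℤ) (q : ℤ) := by
    obtain ⟨k, hk⟩ := hd
    exact ⟨a, -k, by linear_combination hk⟩
  rw [Gsum_complete q hq a b m hd, Gsum_inv q hq a b hd]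
  linear_combination (EE q (-(b * m ^ 2))) * Gsum_sq q hq b hc

lemma coprime_indicator (b q : ℕ) (hq : 0 < q) :
    (if Nat.Coprime b q then (1 : ℂ) else 0) =
      ∑ k ∈ q.divisors, if k ∣ b then ((ArithmeticFunction.moebius k : ℤ) : ℂ) else 0 := by
  rw [← Finset.sum_filter]
  have h1 : q.divisors.filter (· ∣ b) = (Nat.gcd b q).divisors := by
    ext k
    simp only [Finset.mem_filter, Nat.mem_divisors, Nat.dvd_gcd_iff]
    have : Nat.gcd b q ≠ 0 := (Nat.gcd_pos_of_pos_right b hq).ne'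
    have hq2 : q ≠ 0 := hq.ne'
    tauto
  rw [h1]
  have h2 := ArithmeticFunction.coe_mul_zeta_apply (f := ArithmeticFunction.moebius) (x := Nat.gcd b q)
  rw [ArithmeticFunction.moebius_mul_coe_zeta, ArithmeticFunction.one_apply] at h2
  rw [← Int.cast_sum, ← h2]
  unfold Nat.Coprime
  split_ifs <;> simp

/-- the finitely supported coefficient -/
noncomputable def hh (M d : ℕ) : ℂ :=
  if d ∣ M then chi4 d + chi4 ((M / d : ℕ) : ℤ) else 0

lemma chi4_fourier (v : ℕ) : chi4 v = (EE 4 v - EE 4 (-v)) / (2 * Complex.I) := by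
  have hI : (2 * Complex.I) ≠ 0 := by simp
  rw [eq_div_iff hI]
  rcases (by omega : (v : ℤ) % 4 = 0 ∨ (v : ℤ) % 4 = 2 ∨ (v : ℤ) % 4 = 1 ∨ (v : ℤ) % 4 = 3)
    with h | h | h | h
  · rw [EE_congr 4 (by norm_num) (i := (-v : ℤ)) (j := (v : ℤ)) (by push_cast; omega)]
    simp [chi4, h]
  · rw [EE_congr 4 (by norm_num) (i := (-v : ℤ)) (j := (v : ℤ)) (by push_cast; omega)]
    simp [chi4, h]
  · rw [EE_congr 4 (by norm_num) (i := (-v : ℤ)) (j := 3) (by push_cast; omega),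
      EE_congr 4 (by norm_num) (i := (v : ℤ)) (j := 1) (by push_cast; omega), EE_four_one,
      EE_four_three]
    simp [chi4, h]; ring
  · rw [EE_congr 4 (by norm_num) (i := (-v : ℤ)) (j := 1) (by push_cast; omega),
      EE_congr 4 (by norm_num) (i := (v : ℤ)) (j := 3) (by push_cast; omega), EE_four_one,
      EE_four_three]
    simp [chi4, h]; ring

lemma sum_chi4_EE (t N : ℕ) (ht : 0 < t) :
    ∑ v ∈ Finset.range (4 * t), chi4 v * EE (4 * t) (-(v * (N : ℤ))) =
      if t ∣ N then -2 * Complex.I * t * chi4 ((N / t : ℕ) : ℤ) else 0 := by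
  have h4t : 0 < 4 * t := by positivity
  have hI : (2 * Complex.I) ≠ 0 := by simp
  have e1 : ∀ v ∈ Finset.range (4 * t), chi4 v * EE (4 * t) (-(v * (N : ℤ))) =
      (EE (4 * t) (((t : ℤ) - N) * v) - EE (4 * t) ((-((t : ℤ) + N)) * v)) / (2 * Complex.I) := by
    intro v _
    rw [chi4_fourier, ← EE_cancel t 4 ht, ← EE_cancel t 4 ht, mul_comm t 4, div_mul_eq_mul_div,
      sub_mul, ← EE_add, ← EE_add]
    congr 3 <;> ring_nf
  rw [Finset.sum_congr rfl e1, ← Finset.sum_div, Finset.sum_sub_distrib, EE_orth _ h4t,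
    EE_orth _ h4t]
  simp only [dvd_neg, Nat.cast_mul 4 t, Nat.cast_ofNat]
  by_cases hd : t ∣ N
  · obtain ⟨M, rfl⟩ := hd
    rw [if_pos (dvd_mul_right _ _), Nat.mul_div_cancel_left _ ht]
    have ht' : (t : ℤ) ≠ 0 := by exact_mod_cast ht.ne'
    have c1 : (4 * t : ℤ) ∣ (t : ℤ) - ((t * M : ℕ) : ℤ) ↔ (M : ℤ) % 4 = 1 := by
      push_cast
      rw [show (t : ℤ) - t * M = (1 - M) * t by ring, mul_dvd_mul_iff_right ht']
      omega
    have c2 : (4 * t : ℤ) ∣ (t : ℤ) + ((t * M : ℕ) : ℤ) ↔ (M : ℤ) % 4 = 3 := by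
      push_cast
      rw [show (t : ℤ) + t * M = (1 + M) * t by ring, mul_dvd_mul_iff_right ht']
      omega
    simp only [c1, c2, chi4]
    rw [div_eq_iff hI]
    have := Complex.I_mul_I
    split_ifs
    · omega
    · linear_combination (4 * t : ℂ) * this
    · linear_combination (-4 * t : ℂ) * this
    · simp
  · rw [if_neg hd, if_neg, if_neg]
    · simp
    · intro h
      apply hd
      have h2 := (dvd_mul_left (t : ℤ) 4).trans h
      rw [Int.dvd_add_right dvd_rfl] at h2
      exact_mod_cast h2
    · intro h
      apply hd
      have h2 := (dvd_mul_left (t : ℤ) 4).trans h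
      rw [dvd_sub_right dvd_rfl] at h2
      exact_mod_cast h2

lemma inner_eq (k d N : ℕ) (hk : 0 < k) (hd : 0 < d) :
    ∑ v ∈ Finset.range d, eps (k * v) (k * d) * EE d (-(v * (N : ℤ))) =
      d * chi4 k * hh (4 * N) d := by
  by_cases hke : k % 2 = 0
  · have hz : chi4 k = 0 := chi4_even _ (by omega)
    rw [hz, mul_zero, zero_mul]
    apply Finset.sum_eq_zero
    intro v _
    have : (k * d) % 2 = 0 := by simp [Nat.mul_mod, hke]
    simp [eps, this, chi4_mul, hz]
  have hko : k % 2 = 1 := by omega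
  rcases (by omega : d % 2 = 1 ∨ d % 4 = 2 ∨ d % 4 = 0) with h | h | h
  · have h1 : (k * d) % 2 = 1 := by simp [Nat.mul_mod, hko, h]
    simp only [eps, h1, if_true]
    rw [← Finset.mul_sum]
    have e1 : ∀ v ∈ Finset.range d, EE d (-(v * (N : ℤ))) = EE d ((-N : ℤ) * v) := by
      intro v _; congr 1; ring
    rw [Finset.sum_congr rfl e1, EE_orth d hd]
    simp only [dvd_neg]
    have hcop : Nat.Coprime d 4 := by
      have : Nat.Coprime d 2 := (Nat.coprime_two_right).2 (Nat.odd_iff.2 h)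
      exact Nat.Coprime.pow_right 2 this
    have h2 : d ∣ 4 * N ↔ (d : ℤ) ∣ N := by
      rw [hcop.dvd_mul_left, Int.natCast_dvd_natCast]
    simp only [hh, h2]
    split_ifs with h3
    · have h4 : d ∣ N := by exact_mod_cast h3
      rw [Nat.mul_div_assoc _ h4, chi4_even ((4 * (N / d) : ℕ) : ℤ) (by push_cast; omega)]
      push_cast; rw [chi4_mul]; ring
    · simp
  · have h1 : (k * d) % 2 = 0 := by
      have : d % 2 = 0 := by omega
      simp [Nat.mul_mod, this]
    have h2 : (k * d) % 4 = 2 := by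
      rcases (by omega : k % 4 = 1 ∨ k % 4 = 3) with hk4 | hk4 <;> simp [Nat.mul_mod, hk4, h]
    have h3 : hh (4 * N) d = 0 := by
      unfold hh
      split_ifs with h4
      · obtain ⟨c, hc⟩ := h4
        rw [hc, Nat.mul_div_cancel_left _ hd, chi4_even (d : ℤ) (by omega), chi4_even (c : ℤ), add_zero]
        by_contra hcon
        have : (d * c) % 4 = 2 := by
          rcases (by omega : c % 4 = 1 ∨ c % 4 = 3) with hk4 | hk4 <;> simp [Nat.mul_mod, hk4, h]
        omega
      · rfl
    simp [eps, h1, h2, h3]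
  · obtain ⟨t, rfl⟩ := Nat.dvd_of_mod_eq_zero h
    have ht : 0 < t := by omega
    have h1 : (k * (4 * t)) % 2 = 0 := by rw [show k * (4 * t) = 2 * (2 * k * t) by ring]; simp
    have h2 : (k * (4 * t)) % 4 = 0 := by rw [show k * (4 * t) = 4 * (k * t) by ring]; simp
    have e1 : ∀ v ∈ Finset.range (4 * t),
        eps (k * v) (k * (4 * t)) * EE (4 * t) (-(v * (N : ℤ))) =
        (2 * Complex.I * chi4 k) * (chi4 v * EE (4 * t) (-(v * (N : ℤ)))) := by
      intro v _
      simp only [eps, h1, h2, zero_ne_one, if_false, if_true, chi4_mul]; ring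
    rw [Finset.sum_congr rfl e1, ← Finset.mul_sum, sum_chi4_EE t N ht]
    simp only [hh, Nat.mul_dvd_mul_iff_left (by norm_num : 0 < 4)]
    split_ifs with h3
    · rw [Nat.mul_div_mul_left _ _ (by norm_num : 0 < 4),
        chi4_even ((4 * t : ℕ) : ℤ) (by push_cast; omega)]
      rw [Nat.cast_mul, Nat.cast_ofNat]
      linear_combination (-4 * t * chi4 k * chi4 ((N / t : ℕ) : ℤ)) * Complex.I_mul_I
    · simp

lemma Ksum_conv (q : ℕ) (hq : 0 < q) (m : ℕ) :
    Ksum (2 * (m : ℤ)) 0 q = q * ∑ p ∈ q.divisorsAntidiagonal,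
      ((ArithmeticFunction.moebius p.1 : ℤ) : ℂ) * (p.2 * chi4 p.1 * hh (4 * m ^ 2) p.2) := by
  rw [Ksum_eq q hq]
  congr 1
  have e1 : ∀ b ∈ Finset.range q,
      (if Nat.Coprime b q then eps b q * EE q (-(b * (m : ℤ) ^ 2)) else 0) =
      ∑ k ∈ q.divisors, ((ArithmeticFunction.moebius k : ℤ) : ℂ) *
        (if k ∣ b then eps b q * EE q (-(b * (m : ℤ) ^ 2)) else 0) := by
    intro b _
    have := coprime_indicator b q hq
    calc _ = (if Nat.Coprime b q then (1 : ℂ) else 0) * (eps b q * EE q (-(b * (m : ℤ) ^ 2))) := by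
            split_ifs <;> simp
      _ = _ := by
            rw [this, Finset.sum_mul]
            refine Finset.sum_congr rfl fun k _ => ?_
            split_ifs <;> simp
  rw [Finset.sum_congr rfl e1, Finset.sum_comm,
    Nat.sum_divisorsAntidiagonal (fun k d => ((ArithmeticFunction.moebius k : ℤ) : ℂ) *
      (d * chi4 k * hh (4 * m ^ 2) d))]
  refine Finset.sum_congr rfl fun k hk => ?_
  obtain ⟨d, rfl⟩ := Nat.dvd_of_mem_divisors hk
  have hk0 : 0 < k := Nat.pos_of_mul_pos_right hq
  have hd0 : 0 < d := Nat.pos_of_mul_pos_left hq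
  rw [Nat.mul_div_cancel_left _ hk0, ← Finset.mul_sum]
  congr 1
  rw [sum_range_dvd k d hk0 (fun b => eps b (k * d) * EE (k * d) (-(b * (m : ℤ) ^ 2))),
    ← inner_eq k d (m ^ 2) hk0 hd0]
  refine Finset.sum_congr rfl fun v _ => ?_
  congr 1
  rw [← EE_cancel k d hk0]
  congr 1; push_cast; ring

open LSeries.notation in
theorem tsum_aux (m : ℕ) (hm : 0 < m) (s : ℂ) (hs : 1 < s.re) :
    ∑' q : ℕ+, Ksum (2 * (m : ℤ)) 0 (q : ℕ) / ((q : ℕ) : ℂ) ^ ((2 : ℂ) + s) =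
      (∑ d ∈ (4 * m ^ 2).divisors, hh (4 * m ^ 2) d * (d : ℂ) ^ (-s)) / Lchi4 (1 + s) := by
  set χ : DirichletCharacter ℂ 4 := ZMod.χ₄.ringHomComp (Int.castRingHom ℂ) with hχ
  set M := 4 * m ^ 2 with hM
  have hM0 : M ≠ 0 := by positivity
  set μ' : ℕ → ℂ := (fun k : ℕ => χ (k : ZMod 4)) * (fun k : ℕ => ((ArithmeticFunction.moebius k : ℤ) : ℂ)) with hμ
  have hs1 : 1 < (1 + s).re := by simp; linarith
  have hL : Lchi4 (1 + s) * LSeries μ' (1 + s) = 1 := by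
    have h1 := DirichletCharacter.LSeries.mul_mu_eq_one χ hs1
    rw [Lchi4, DirichletCharacter.LFunction_eq_LSeries _ hs1]
    exact h1
  have hsum1 : LSeriesSummable μ' (1 + s) :=
    DirichletCharacter.LSeriesSummable_mul χ (ArithmeticFunction.LSeriesSummable_moebius_iff.mpr hs1)
  set h' : ℕ → ℂ := fun d => d * hh M d with hh'
  have hsupp : ∀ d ∉ M.divisors, LSeries.term h' (1 + s) d = 0 := by
    intro d hd
    rcases Nat.eq_zero_or_pos d with rfl | hd0
    · simp
    rw [LSeries.term_of_ne_zero hd0.ne', hh']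
    have : ¬ d ∣ M := fun h => hd (Nat.mem_divisors.2 ⟨h, hM0⟩)
    simp [hh, this]
  have hsum2 : LSeriesSummable h' (1 + s) := summable_of_ne_finset_zero hsupp
  have hL2 : LSeries h' (1 + s) = ∑ d ∈ M.divisors, hh M d * (d : ℂ) ^ (-s) := by
    rw [LSeries, tsum_eq_sum hsupp]
    refine Finset.sum_congr rfl fun d hd => ?_
    have hd0 : d ≠ 0 := (Nat.pos_of_mem_divisors hd).ne'
    have hdc : (d : ℂ) ≠ 0 := by exact_mod_cast hd0
    rw [LSeries.term_of_ne_zero hd0, hh', Complex.cpow_add _ _ hdc, Complex.cpow_one,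
      Complex.cpow_neg]
    field_simp
  have hconv := LSeries_convolution' hsum1 hsum2
  have hLne : Lchi4 (1 + s) ≠ 0 := left_ne_zero_of_mul_eq_one hL
  rw [eq_div_iff hLne, ← hL2]
  have hT : ∑' q : ℕ+, Ksum (2 * (m : ℤ)) 0 (q : ℕ) / ((q : ℕ) : ℂ) ^ ((2 : ℂ) + s) =
      LSeries (μ' ⍟ h') (1 + s) := by
    rw [LSeries, ← PNat.coe_injective.tsum_eq (f := LSeries.term (μ' ⍟ h') (1 + s)) (by
      intro k hk
      rcases Nat.eq_zero_or_pos k with rfl | h0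
      · simp at hk
      · exact ⟨⟨k, h0⟩, rfl⟩)]
    refine tsum_congr fun q => ?_
    have hq0 : (q : ℕ) ≠ 0 := q.pos.ne'
    have hqc : ((q : ℕ) : ℂ) ≠ 0 := by exact_mod_cast hq0
    rw [LSeries.term_of_ne_zero hq0, Ksum_conv q q.pos m, LSeries.convolution_def,
      show (2 : ℂ) + s = 1 + (1 + s) by ring, Complex.cpow_add _ _ hqc, Complex.cpow_one,
      mul_div_mul_left _ _ hqc]
    congr 1
    refine Finset.sum_congr rfl fun p _ => ?_
    have : χ ((p.1 : ℕ) : ZMod 4) = chi4 p.1 := by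
      rw [chi4_eq, hχ, MulChar.ringHomComp_apply]; simp
    simp only [hμ, hh', Pi.mul_apply, this]; ring
  rw [hT, hconv]
  linear_combination (LSeries h' (1 + s)) * hL

/-- the diagonal term for even `n`. -/
theorem tsum_Ksum_even (n : ℕ) (hn : 0 < n) (hne : Even n) (s : ℂ) (hs : 1 < s.re) :
    ∑' q : ℕ+, Ksum (n : ℤ) 0 (q : ℕ) / ((q : ℕ) : ℂ) ^ ((2 : ℂ) + s) =
      ((n : ℂ) ^ (-(2 * s)) * sigmaChi4 s (n ^ 2) + sigmaChi4 (-s) (n ^ 2)) /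
        Lchi4 (1 + s) := by
  obtain ⟨m, hm⟩ := hne
  have hn2 : n ^ 2 = 4 * m ^ 2 := by rw [hm]; ring
  have hnm : (n : ℤ) = 2 * (m : ℤ) := by omega
  have hn0 : n ^ 2 ≠ 0 := by positivity
  have hnc : (n : ℂ) ≠ 0 := by exact_mod_cast hn.ne'
  rw [hnm, tsum_aux m (by omega) s hs, ← hn2]
  congr 1
  have e1 : ∀ d ∈ (n ^ 2).divisors, hh (n ^ 2) d * (d : ℂ) ^ (-s) =
      chi4 ((n ^ 2 / d : ℕ) : ℤ) * (d : ℂ) ^ (-s) + chi4 d * (d : ℂ) ^ (-s) := by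
    intro d hd
    rw [hh, if_pos (Nat.dvd_of_mem_divisors hd)]; ring
  rw [Finset.sum_congr rfl e1, Finset.sum_add_distrib]
  congr 1
  rw [← Nat.sum_div_divisors, sigmaChi4, Finset.mul_sum]
  refine Finset.sum_congr rfl fun d hd => ?_
  obtain ⟨c, hc⟩ := Nat.dvd_of_mem_divisors hd
  have hd0 : 0 < d := Nat.pos_of_mem_divisors hd
  have hc0 : 0 < c := by
    rcases Nat.eq_zero_or_pos c with rfl | h
    · simp at hc; omega
    · exact h
  have hdc : (d : ℂ) ≠ 0 := by exact_mod_cast hd0.ne'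
  have e2 : n ^ 2 / d = c := by rw [hc, Nat.mul_div_cancel_left _ hd0]
  have e3 : n ^ 2 / c = d := by rw [hc, Nat.mul_div_cancel _ hc0]
  rw [e2, e3]
  have e4 : (n : ℂ) ^ (-(2 * s)) = (d : ℂ) ^ (-s) * (c : ℂ) ^ (-s) := by
    rw [← Complex.natCast_mul_natCast_cpow, ← Nat.cast_mul, ← hc, sq, Nat.cast_mul,
      Complex.natCast_mul_natCast_cpow, ← Complex.cpow_add _ _ hnc]
    congr 1; ring
  rw [e4, Complex.cpow_neg, Complex.cpow_neg]
  have : (d : ℂ) ^ s ≠ 0 := by simp [Complex.cpow_eq_zero_iff, hdc]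
  field_simp
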